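/- arXiv:math/0509115 — 2 statements merged into one kernel-verified Lean document; each statement's English description precedes it below -/
import Mathlib

section
/- Let n ≥ 1 and let π be a group. Let X denote the set of group homomorphisms π → SU(n), regarded as a measurable subspace of the product space of functions π → SU(n) (with the Borel σ-algebra of the product topology), and let μ be a finite Borel measure on X. Let u : π → SU(n) be a homomorphism taking values in the center of SU(n), so that for each γ ∈ π, u(γ) = ζ(γ)·I with ζ(γ) ∈ ℂ an n-th root of unity, and suppose the map X → X sending ρ to the homomorphism γ ↦ ρ(γ)·u(γ) preserves μ. Let γ₁, …, γ_s ∈ π be such that ζ(γ₁)·ζ(γ₂)⋯ζ(γ_s) ≠ 1. Then ∫_X tr(ρ(γ₁)) · tr(ρ(γ₂)) ⋯ tr(ρ(γ_s)) dμ(ρ) = 0. -/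
open MeasureTheory

/-- The space of functions `π → SU(n)` carries the Borel σ-algebra of the product
topology. -/
noncomputable instance funSUMeasurableSpace (π : Type*) (n : ℕ) :
    MeasurableSpace (π → Matrix.specialUnitaryGroup (Fin n) ℂ) := borel _

/-- The representation space `X = Hom(π, SU(n))`: the set of group homomorphisms
`π → SU(n)`, as a measurable subspace of the product space `π → SU(n)`. -/
def RepSpace (π : Type*) [Group π] (n : ℕ) : Type _ :=
  {f : π → Matrix.specialUnitaryGroup (Fin n) ℂ //
    f 1 = 1 ∧ ∀ x y : π, f (x * y) = f x * f y}

noncomputable instance (π : Type*) [Group π] (n : ℕ) :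
    MeasurableSpace (RepSpace π n) := by
  unfold RepSpace; infer_instance

/-- The trace function of a tuple of group elements is measurable on the representation space. -/
theorem measurable_prod_trace (π : Type*) [Group π] (n s : ℕ) (γs : Fin s → π) :
    Measurable fun ρ : RepSpace π n =>
      ∏ i, Matrix.trace ((ρ.1 (γs i) : Matrix (Fin n) (Fin n) ℂ)) := by
  have hval : Measurable fun ρ : RepSpace π n => ρ.1 := measurable_subtype_coe
  have : BorelSpace (π → Matrix.specialUnitaryGroup (Fin n) ℂ) := ⟨rfl⟩
  have hcont : Continuous fun f : π → Matrix.specialUnitaryGroup (Fin n) ℂ =>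
      ∏ i, Matrix.trace ((f (γs i) : Matrix (Fin n) (Fin n) ℂ)) :=
    continuous_finsetProd _ fun i _ =>
      (continuous_subtype_val.comp (continuous_apply (γs i))).matrix_trace
  exact hcont.measurable.comp hval

/-- If `u : π →* SU(n)` is central, `u γ = ζ γ • I`, the map `ρ ↦ (γ ↦ ρ γ * u γ)`
preserves the finite measure `μ` on `X = Hom(π, SU(n))`, and
`ζ(γ₁) ⋯ ζ(γ_s) ≠ 1`, then `∫ tr ρ(γ₁) ⋯ tr ρ(γ_s) dμ(ρ) = 0`. -/
theorem integral_trace_prod_eq_zero (n : ℕ) (hn : 1 ≤ n)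
    (π : Type*) [Group π]
    (μ : Measure (RepSpace π n)) [IsFiniteMeasure μ]
    (u : π →* Matrix.specialUnitaryGroup (Fin n) ℂ) (ζ : π → ℂ)
    (hu : ∀ γ : π, ((u γ : Matrix (Fin n) (Fin n) ℂ)) =
      ζ γ • (1 : Matrix (Fin n) (Fin n) ℂ))
    (T : RepSpace π n → RepSpace π n)
    (hT : ∀ (ρ : RepSpace π n) (γ : π), (T ρ).1 γ = ρ.1 γ * u γ)
    (hTmeas : Measurable T)
    (hTμ : Measure.map T μ = μ)
    (s : ℕ) (γs : Fin s → π)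
    (hζ : (∏ i, ζ (γs i)) ≠ 1) :
    ∫ ρ : RepSpace π n,
      (∏ i, Matrix.trace ((ρ.1 (γs i) : Matrix (Fin n) (Fin n) ℂ))) ∂μ = 0 := by
  set F : RepSpace π n → ℂ := fun ρ =>
    ∏ i, Matrix.trace ((ρ.1 (γs i) : Matrix (Fin n) (Fin n) ℂ))
  have hF : Measurable F := measurable_prod_trace π n s γs
  have hFT (ρ : RepSpace π n) : F (T ρ) = (∏ i, ζ (γs i)) * F ρ := by
    simp [F, hT, hu, Matrix.trace_smul, Finset.prod_mul_distrib]
  have hint : ∫ ρ, F ρ ∂μ = (∏ i, ζ (γs i)) * ∫ ρ, F ρ ∂μ := by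
    calc ∫ ρ, F ρ ∂μ = ∫ ρ, F ρ ∂(Measure.map T μ) := by rw [hTμ]
      _ = ∫ ρ, F (T ρ) ∂μ := integral_map hTmeas.aemeasurable hF.aestronglyMeasurable
      _ = (∏ i, ζ (γs i)) * ∫ ρ, F ρ ∂μ := by simp_rw [hFT, integral_const_mul]
  by_contra h
  exact hζ (mul_right_cancel₀ h (by rw [one_mul]; exact hint.symm))
end

section
/- Let n ≥ 1 and let π be a group. Let X denote the set of group homomorphisms π → SU(n), regarded as a measurable subspace of the product space of functions π → SU(n), and let μ be a finite Borel measure on X with μ(X) = 1. Let u : π → SU(n) be a homomorphism taking values in the center of SU(n), with u(γ) = ζ(γ)·I for scalars ζ(γ) ∈ ℂ, and suppose the map X → X sending ρ to the homomorphism γ ↦ ρ(γ)·u(γ) preserves μ. Let γ₁, …, γ_s ∈ π satisfy ζ(γ₁)·ζ(γ₂)⋯ζ(γ_s) = 1, and let α ∈ π satisfy ζ(α) ≠ 1. Define t_γ(ρ) = tr(ρ(γ₁))⋯tr(ρ(γ_s)), t_α(ρ) = tr(ρ(α)), and the normalized function t̂_γ = t_γ − ∫_X t_γ dμ. Then the L²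 inner product of t̂_γ and t_α vanishes: ∫_X t̂_γ(ρ) · conj(t_α(ρ)) dμ(ρ) = 0. -/
open MeasureTheory

/-- A function that a measure-preserving map multiplies by a constant `c ≠ 1` has integral zero. -/
theorem MeasureTheory.MeasurePreserving.integral_eq_zero_of_comp_eq_const_mul
    {X : Type*} [MeasurableSpace X] {μ : Measure X} {T : X → X} (hT : MeasurePreserving T μ μ)
    {f : X → ℂ} {c : ℂ} (hc : c ≠ 1) (hf : ∀ x, f (T x) = c * f x) :
    ∫ x, f x ∂μ = 0 := by
  by_cases hm : AEStronglyMeasurable f μ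
  · have h : ∫ x, f x ∂μ = c * ∫ x, f x ∂μ := by
      calc ∫ x, f x ∂μ = ∫ x, f x ∂(μ.map T) := by rw [hT.map_eq]
        _ = ∫ x, f (T x) ∂μ :=
          integral_map hT.measurable.aemeasurable (by rwa [hT.map_eq])
        _ = c * ∫ x, f x ∂μ := by simp_rw [hf, integral_const_mul]
    by_contra h0
    exact hc (mul_right_cancel₀ h0 (by rw [one_mul, ← h]))
  · exact integral_undef fun hi => hm hi.aestronglyMeasurable

/-- Let `u : π →* SU(n)` be central, `u γ = ζ γ • I`, and suppose the map
`ρ ↦ (γ ↦ ρ γ * u γ)` preserves the probability measure `μ` on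
`X = Hom(π, SU(n))`.  If `ζ(γ₁) ⋯ ζ(γ_s) = 1` and `ζ α ≠ 1`, then the normalized
trace function `t̂_γ = t_γ - ∫ t_γ dμ` of the tuple `γ = (γ₁, …, γ_s)` is
orthogonal in `L²(X, μ)` to the trace function `t_α`. -/
theorem normalized_trace_orthogonal (n : ℕ) (hn : 1 ≤ n)
    (π : Type*) [Group π]
    (μ : Measure (RepSpace π n)) [IsProbabilityMeasure μ]
    (u : π →* Matrix.specialUnitaryGroup (Fin n) ℂ) (ζ : π → ℂ)
    (hu : ∀ γ : π, ((u γ : Matrix (Fin n) (Fin n) ℂ)) =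
      ζ γ • (1 : Matrix (Fin n) (Fin n) ℂ))
    (T : RepSpace π n → RepSpace π n)
    (hT : ∀ (ρ : RepSpace π n) (γ : π), (T ρ).1 γ = ρ.1 γ * u γ)
    (hTmeas : Measurable T)
    (hTμ : Measure.map T μ = μ)
    (s : ℕ) (γs : Fin s → π) (α : π)
    (hζγ : (∏ i, ζ (γs i)) = 1) (hζα : ζ α ≠ 1)
    (tγ tα : RepSpace π n → ℂ)
    (htγ : ∀ ρ : RepSpace π n,
      tγ ρ = ∏ i, Matrix.trace ((ρ.1 (γs i) : Matrix (Fin n) (Fin n) ℂ)))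
    (htα : ∀ ρ : RepSpace π n,
      tα ρ = Matrix.trace ((ρ.1 α : Matrix (Fin n) (Fin n) ℂ))) :
    ∫ ρ : RepSpace π n,
      (tγ ρ - ∫ ρ' : RepSpace π n, tγ ρ' ∂μ) * (starRingEnd ℂ) (tα ρ) ∂μ = 0 := by
  have htr (ρ : RepSpace π n) (γ : π) :
      Matrix.trace ((T ρ).1 γ : Matrix (Fin n) (Fin n) ℂ) =
        ζ γ * Matrix.trace (ρ.1 γ : Matrix (Fin n) (Fin n) ℂ) := by
    rw [hT, Submonoid.coe_mul, hu, mul_smul_comm, mul_one, Matrix.trace_smul, smul_eq_mul]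
  have hγ (ρ : RepSpace π n) : tγ (T ρ) = tγ ρ := by
    simp_rw [htγ, htr, Finset.prod_mul_distrib, hζγ, one_mul]
  have hα (ρ : RepSpace π n) : tα (T ρ) = ζ α * tα ρ := by
    rw [htα, htα, htr]
  refine MeasurePreserving.integral_eq_zero_of_comp_eq_const_mul (T := T) ⟨hTmeas, hTμ⟩
    (c := (starRingEnd ℂ) (ζ α)) (by rwa [Ne, map_eq_one_iff _ (starRingEnd ℂ).injective])
    fun ρ => ?_
  rw [hγ, hα, map_mul]
  ring
end
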